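/- Asymptotically almost all d-regular graphs on n vertices are asymmetric, for every fixed d ≥ 3: the proportion of labelled d-regular graphs on n vertices whose automorphism group is trivial tends to 1 as n → ∞. -/

import Mathlib

/-- A graph is asymmetric if its only automorphism is the identity. -/
def IsAsymmetric {V : Type} (G : SimpleGraph V) : Prop := ∀ e : G ≃g G, ∀ v, e v = v

section RandomRegularGraphs

open Finset

namespace SimpleGraph

section Switching

variable {V : Type*} {G : SimpleGraph V} {u v x y : V}

/-- The graph obtained from `G` by replacing the edges `uv` and `xy` with `ux` and `vy`. -/
def switch (G : SimpleGraph V) (u v x y : V) : SimpleGraph V :=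
  fromEdgeSet ((G.edgeSet \ {s(u, v), s(x, y)}) ∪ {s(u, x), s(v, y)})

theorem switch_adj {a b : V} : (G.switch u v x y).Adj a b ↔
    ((G.Adj a b ∧ s(a, b) ≠ s(u, v) ∧ s(a, b) ≠ s(x, y)) ∨
      s(a, b) = s(u, x) ∨ s(a, b) = s(v, y)) ∧ a ≠ b := by
  simp only [switch, fromEdgeSet_adj, Set.mem_union, Set.mem_sdiff, Set.mem_insert_iff,
    Set.mem_singleton_iff, mem_edgeSet, not_or, ne_eq]

theorem switch_switch (huv : G.Adj u v) (hxy : G.Adj x y) (hux : ¬ G.Adj u x)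
    (hvy : ¬ G.Adj v y) (hux' : u ≠ x) (hvy' : v ≠ y) :
    (G.switch u v x y).switch u x v y = G := by
  have huv' := huv.ne
  have hxy' := hxy.ne
  ext a b
  have hvu := huv.symm
  have hyx := hxy.symm
  have hab : G.Adj a b → a ≠ b := fun h => h.ne
  have hux₂ : ¬ G.Adj x u := fun h => hux h.symm
  have hvy₂ : ¬ G.Adj y v := fun h => hvy h.symm
  rw [switch_adj, switch_adj]
  simp only [ne_eq, Sym2.eq_iff]
  constructor
  · rintro ⟨h | h, -⟩
    · tauto
    · rcases h with (⟨rfl, rfl⟩ | ⟨rfl, rfl⟩) | (⟨rfl, rfl⟩ | ⟨rfl, rfl⟩) <;> assumption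
  · intro h
    refine ⟨?_, hab h⟩
    by_cases h₃ : a = u ∧ b = v ∨ a = v ∧ b = u
    · exact Or.inr (Or.inl h₃)
    by_cases h₄ : a = x ∧ b = y ∨ a = y ∧ b = x
    · exact Or.inr (Or.inr h₄)
    refine Or.inl ⟨⟨Or.inl ⟨h, h₃, h₄⟩, hab h⟩, ?_, ?_⟩
    · rintro (⟨rfl, rfl⟩ | ⟨rfl, rfl⟩) <;> contradiction
    · rintro (⟨rfl, rfl⟩ | ⟨rfl, rfl⟩) <;> contradiction

theorem ncard_neighborSet_switch (huv : G.Adj u v) (hxy : G.Adj x y) (hux : ¬ G.Adj u x)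
    (hvy : ¬ G.Adj v y) (hux' : u ≠ x) (hvy' : v ≠ y) (a : V) :
    ((G.switch u v x y).neighborSet a).ncard = (G.neighborSet a).ncard := by
  have huv' := huv.ne
  have hxy' := hxy.ne
  have hvx : v ≠ x := by rintro rfl; exact hux huv
  have huy : u ≠ y := by rintro rfl; exact hvy huv.symm
  have key : ∀ b c, ¬ G.Adj a b → G.Adj a c →
      (G.switch u v x y).neighborSet a = insert b (G.neighborSet a \ {c}) →
      ((G.switch u v x y).neighborSet a).ncard = (G.neighborSet a).ncard := by
    intro b c hb hc h
    rw [h]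
    exact Set.ncard_exchange hb hc
  have hvu := huv.symm
  have hyx := hxy.symm
  by_cases h1 : a = u
  · subst h1
    refine key x v hux huv ?_
    ext b
    simp only [mem_neighborSet, switch_adj, Sym2.eq_iff, Set.mem_insert_iff, Set.mem_sdiff,
      Set.mem_singleton_iff]
    grind [SimpleGraph.Adj.ne]
  by_cases h2 : a = v
  · subst h2
    refine key y u hvy hvu ?_
    ext b
    simp only [mem_neighborSet, switch_adj, Sym2.eq_iff, Set.mem_insert_iff, Set.mem_sdiff,
      Set.mem_singleton_iff]
    grind [SimpleGraph.Adj.ne]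
  by_cases h3 : a = x
  · subst h3
    refine key u y (fun h => hux h.symm) hxy ?_
    ext b
    simp only [mem_neighborSet, switch_adj, Sym2.eq_iff, Set.mem_insert_iff, Set.mem_sdiff,
      Set.mem_singleton_iff]
    grind [SimpleGraph.Adj.ne]
  by_cases h4 : a = y
  · subst h4
    refine key v x (fun h => hvy h.symm) hyx ?_
    ext b
    simp only [mem_neighborSet, switch_adj, Sym2.eq_iff, Set.mem_insert_iff, Set.mem_sdiff,
      Set.mem_singleton_iff]
    grind [SimpleGraph.Adj.ne]
  congr 1
  ext b
  simp only [mem_neighborSet, switch_adj, Sym2.eq_iff]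
  grind [SimpleGraph.Adj.ne]

end Switching

section Containing

variable {V : Type*} [Fintype V]

open Classical in
/-- The `d`-regular graphs on `V` that contain all the edges in `H`. -/
noncomputable def regularContaining (d : ℕ) (H : Finset (Sym2 V)) : Finset (SimpleGraph V) :=
  {G | (∀ v, (G.neighborSet v).ncard = d) ∧ (H : Set (Sym2 V)) ⊆ G.edgeSet}

theorem mem_regularContaining {d : ℕ} {H : Finset (Sym2 V)} {G : SimpleGraph V} :
    G ∈ regularContaining d H ↔
      (∀ v, (G.neighborSet v).ncard = d) ∧ (H : Set (Sym2 V)) ⊆ G.edgeSet := by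
  simp [regularContaining]

open Classical in
/-- The pairs `(x, y)` for which `G.switch u v x y` keeps the degrees of `G` and the edges
in `H`. -/
noncomputable def switchPairs (G : SimpleGraph V) (H : Finset (Sym2 V)) (u v : V) :
    Finset (V × V) :=
  {p | G.Adj p.1 p.2 ∧ s(p.1, p.2) ∉ insert s(u, v) H ∧ ¬ G.Adj u p.1 ∧ u ≠ p.1 ∧
    ¬ G.Adj v p.2 ∧ v ≠ p.2}

open Classical in
theorem card_filter_adj {d : ℕ} {G : SimpleGraph V} (hG : ∀ v, (G.neighborSet v).ncard = d)
    (v : V) :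
    #{x | G.Adj v x} = d := by
  rw [← hG v, Set.ncard_eq_toFinset_card']
  congr 1
  ext
  simp

open Classical in
theorem card_adj_pairs {d : ℕ} {G : SimpleGraph V} (hG : ∀ v, (G.neighborSet v).ncard = d) :
    #{p : V × V | G.Adj p.1 p.2} = Fintype.card V * d := by
  rw [card_filter, Fintype.sum_prod_type]
  simp_rw [← card_filter]
  rw [sum_const_nat fun v _ => card_filter_adj hG v, card_univ]

open Classical in
theorem card_pairs_mem_le (H : Finset (Sym2 V)) : #{p : V × V | s(p.1, p.2) ∈ H} ≤ 2 * #H := by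
  rw [mul_comm]
  have : #{p : V × V | s(p.1, p.2) ∈ H} = ∑ e ∈ H, #{p : V × V | s(p.1, p.2) = e} := by
    rw [Finset.card_eq_sum_card_fiberwise (f := fun p : V × V => s(p.1, p.2)) (t := H)]
    · refine Finset.sum_congr rfl fun e he => ?_
      congr 1
      ext p
      simp only [mem_filter, mem_univ, true_and]
      exact ⟨fun h => h.2, fun h => ⟨h ▸ he, h⟩⟩
    · intro p hp
      simpa using hp
  rw [this, ← smul_eq_mul]
  refine Finset.sum_le_card_nsmul _ _ _ fun e _ => ?_
  induction e with
  | _ a b =>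
    refine (card_le_card (t := {(a, b), (b, a)}) ?_).trans card_le_two
    rintro ⟨c, e⟩
    simp

open Classical in
theorem card_pairs_near_le {d : ℕ} {G : SimpleGraph V}
    (hG : ∀ v, (G.neighborSet v).ncard = d) (u : V) :
    #{p : V × V | G.Adj p.1 p.2 ∧ (G.Adj u p.1 ∨ u = p.1)} ≤ (d + 1) * d := by
  have h : ({p : V × V | G.Adj p.1 p.2 ∧ (G.Adj u p.1 ∨ u = p.1)} : Finset (V × V)) ⊆
      (insert u ({x | G.Adj u x} : Finset V)).biUnion fun v =>
        ({x | G.Adj v x} : Finset V).image (Prod.mk v) := by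
    rintro ⟨a, b⟩
    simp only [mem_filter, mem_univ, true_and, mem_biUnion, mem_insert, mem_image, Prod.mk.injEq]
    rintro ⟨h, h'⟩
    exact ⟨a, h'.symm.imp Eq.symm id, b, h, rfl, rfl⟩
  refine (card_le_card h).trans ?_
  refine (card_biUnion_le_card_mul _ _ d fun v _ =>
    card_image_le.trans (card_filter_adj hG v).le).trans ?_
  gcongr
  exact (card_insert_le _ _).trans (by rw [card_filter_adj hG])

theorem le_card_switchPairs {d : ℕ} {G : SimpleGraph V}
    (hG : ∀ v, (G.neighborSet v).ncard = d) (H : Finset (Sym2 V)) (u v : V) :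
    Fintype.card V * d - 2 * (#H + 1) - 2 * ((d + 1) * d) ≤ #(G.switchPairs H u v) := by
  classical
  have hsub : ({p : V × V | G.Adj p.1 p.2} : Finset (V × V)) ⊆
      G.switchPairs H u v ∪ ({p : V × V | s(p.1, p.2) ∈ insert s(u, v) H} : Finset (V × V)) ∪
      ({p : V × V | G.Adj p.1 p.2 ∧ (G.Adj u p.1 ∨ u = p.1)} : Finset (V × V)) ∪
      ({p : V × V | G.Adj p.1 p.2 ∧ (G.Adj v p.1 ∨ v = p.1)} : Finset (V × V)).image Prod.swap := by
    rintro ⟨a, b⟩ h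
    simp only [mem_filter, mem_univ, true_and, switchPairs, mem_union, mem_image, Prod.exists,
      Prod.swap_prod_mk, Prod.mk.injEq] at h ⊢
    by_cases h1 : s(a, b) ∈ insert s(u, v) H
    · tauto
    by_cases h2 : G.Adj u a ∨ u = a
    · tauto
    by_cases h3 : G.Adj v b ∨ v = b
    · exact Or.inr ⟨b, a, ⟨h.symm, h3⟩, rfl, rfl⟩
    tauto
  have h := card_le_card hsub
  rw [card_adj_pairs hG] at h
  have h1 := card_pairs_mem_le (insert s(u, v) H)
  have h2 := card_insert_le s(u, v) H
  have h3 := card_pairs_near_le hG u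
  have h4 := (card_image_le (f := Prod.swap)).trans (card_pairs_near_le hG v)
  have h5 := h.trans (card_union_le _ _)
  have h6 := h5.trans (Nat.add_le_add_right (card_union_le _ _) _)
  have h7 := h6.trans (Nat.add_le_add_right (Nat.add_le_add_right (card_union_le _ _) _) _)
  omega

open Classical in
theorem card_regularContaining_insert (d : ℕ) (H : Finset (Sym2 V)) {e : Sym2 V} (he : e ∉ H) :
    #(regularContaining d (insert e H)) *
      (Fintype.card V * d - 2 * (#H + 1) - 2 * ((d + 1) * d)) ≤
    #(regularContaining d H) * d ^ 2 := by
  induction e with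
  | _ u v =>
  let A := (regularContaining d (insert s(u, v) H)).sigma fun G => G.switchPairs H u v
  let B := (regularContaining d H).sigma fun G =>
    ({x | G.Adj u x} : Finset V) ×ˢ ({y | G.Adj v y} : Finset V)
  have hA : #(regularContaining d (insert s(u, v) H)) *
      (Fintype.card V * d - 2 * (#H + 1) - 2 * ((d + 1) * d)) ≤ #A := by
    rw [card_sigma, ← smul_eq_mul]
    exact card_nsmul_le_sum _ _ _ fun G hG =>
      le_card_switchPairs (mem_regularContaining.1 hG).1 H u v
  have hB : #B = #(regularContaining d H) * d ^ 2 := by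
    rw [card_sigma, ← smul_eq_mul]
    refine sum_const_nat fun G hG => ?_
    have := (mem_regularContaining.1 hG).1
    rw [card_product, card_filter_adj this, card_filter_adj this, sq]
  refine hA.trans (le_trans ?_ hB.le)
  have hprop : ∀ q ∈ A, (∀ a, (q.1.neighborSet a).ncard = d) ∧
      (H : Set (Sym2 V)) ⊆ q.1.edgeSet ∧ q.1.Adj u v ∧
      q.1.Adj q.2.1 q.2.2 ∧ s(q.2.1, q.2.2) ∉ H ∧ ¬ q.1.Adj u q.2.1 ∧ u ≠ q.2.1 ∧
        ¬ q.1.Adj v q.2.2 ∧ v ≠ q.2.2 := by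
    rintro ⟨G, x, y⟩ hq
    simp only [A, mem_sigma, mem_regularContaining, switchPairs, mem_filter, mem_univ,
      true_and, coe_insert, Set.insert_subset_iff, mem_insert, not_or, mem_edgeSet] at hq
    tauto
  refine card_le_card_of_injOn (fun q => ⟨q.1.switch u v q.2.1 q.2.2, q.2⟩) ?_ ?_
  · rintro ⟨G, x, y⟩ hq
    obtain ⟨h1, h2, h3, h4, h5, h6, h7, h8, h9⟩ := hprop _ hq
    dsimp only at h1 h2 h3 h4 h5 h6 h7 h8 h9
    simp only [B, coe_sigma, Set.mem_sigma_iff, mem_coe, mem_regularContaining, mem_product,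
      mem_filter, mem_univ, true_and]
    refine ⟨⟨fun a => ?_, ?_⟩, ?_, ?_⟩
    · rw [ncard_neighborSet_switch h3 h4 h6 h8 h7 h9, h1]
    · intro f hf
      have hf' := h2 hf
      induction f with
      | _ a b =>
      rw [mem_edgeSet] at hf' ⊢
      rw [switch_adj]
      refine ⟨Or.inl ⟨hf', ?_, ?_⟩, hf'.ne⟩
      · intro h; exact he (h ▸ hf)
      · intro h; exact h5 (h ▸ hf)
    · rw [switch_adj]; exact ⟨by simp, h7⟩
    · rw [switch_adj]; exact ⟨by simp, h9⟩
  · rintro ⟨G, x, y⟩ hq ⟨G', x', y'⟩ hq' h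
    obtain ⟨h1, h2, h3, h4, h5, h6, h7, h8, h9⟩ := hprop _ hq
    obtain ⟨k1, k2, k3, k4, k5, k6, k7, k8, k9⟩ := hprop _ hq'
    simp only [Sigma.mk.injEq, heq_eq_eq, Prod.mk.injEq] at h
    obtain ⟨h, rfl, rfl⟩ := h
    have e1 := switch_switch h3 h4 h6 h8 h7 h9
    have e2 := switch_switch k3 k4 k6 k8 k7 k9
    dsimp only at e1 e2
    rw [h, e2] at e1
    rw [e1]

open Classical in
/-- The `d`-regular graphs on `V` that have `σ` as an automorphism. -/
noncomputable def regularFixed (d : ℕ) (σ : Equiv.Perm V) : Finset (SimpleGraph V) :=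
  {G ∈ regularContaining d ∅ | ∀ u v, G.Adj u v → G.Adj (σ u) (σ v)}

theorem mem_regularFixed {d : ℕ} {σ : Equiv.Perm V} {G : SimpleGraph V} :
    G ∈ regularFixed d σ ↔
      G ∈ regularContaining d ∅ ∧ ∀ u v, G.Adj u v → G.Adj (σ u) (σ v) := by
  simp [regularFixed]

end Containing

end SimpleGraph

theorem Nat.pow_le_exp_pow_mul_descFactorial {M m : ℕ} (h : m ≤ M) :
    (M : ℝ) ^ m ≤ Real.exp 1 ^ m * M.descFactorial m := by
  induction M generalizing m with
  | zero => simp [Nat.le_zero.1 h]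
  | succ M ih =>
    cases m with
    | zero => simp
    | succ m =>
      have hm : m ≤ M := by omega
      have h₁ : ((M : ℝ) + 1) ^ m ≤ Real.exp 1 * (M : ℝ) ^ m := by
        rcases Nat.eq_zero_or_pos M with rfl | hM
        · simp [Nat.le_zero.1 hm]
        have hM' : (0 : ℝ) < M := by exact_mod_cast hM
        calc ((M : ℝ) + 1) ^ m = (1 / M + 1) ^ m * (M : ℝ) ^ m := by
              rw [← mul_pow]; congr 1; field_simp; ring
          _ ≤ Real.exp (1 / M) ^ m * (M : ℝ) ^ m := by
              gcongr
              exact Real.add_one_le_exp _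
          _ ≤ Real.exp 1 * (M : ℝ) ^ m := by
              gcongr
              rw [← Real.exp_nat_mul]
              gcongr
              rw [mul_one_div]
              exact div_le_one_of_le₀ (by exact_mod_cast hm) hM'.le
      rw [Nat.succ_descFactorial_succ]
      push_cast
      calc ((M : ℝ) + 1) ^ (m + 1) = ((M : ℝ) + 1) ^ m * (M + 1) := pow_succ _ _
        _ ≤ Real.exp 1 * (M : ℝ) ^ m * (M + 1) := by gcongr
        _ ≤ Real.exp 1 * (Real.exp 1 ^ m * M.descFactorial m) * (M + 1) := by
            gcongr
            exact ih hm
        _ = _ := by ring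

namespace SimpleGraph

theorem card_regularContaining_mul_descFactorial_le {V : Type*} [Fintype V] (d : ℕ)
    (H : Finset (Sym2 V)) :
    #(regularContaining d H) *
        ((Fintype.card V * d - 2 - 2 * ((d + 1) * d)) / 2).descFactorial #H ≤
      #(regularContaining d (∅ : Finset (Sym2 V))) * (d ^ 2) ^ #H := by
  classical
  set N := Fintype.card V * d - 2 - 2 * ((d + 1) * d) with hN
  induction H using Finset.induction_on with
  | empty => simp
  | insert e H he ih =>
    have h := card_regularContaining_insert d H he
    have hle : N / 2 - #H ≤ Fintype.card V * d - 2 * (#H + 1) - 2 * ((d + 1) * d) := by omega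
    rw [card_insert_of_notMem he, Nat.descFactorial_succ]
    calc _ = #(regularContaining d (insert e H)) * (N / 2 - #H) * (N / 2).descFactorial #H := by
          ring
      _ ≤ #(regularContaining d H) * d ^ 2 * (N / 2).descFactorial #H :=
          Nat.mul_le_mul_right _ ((Nat.mul_le_mul_left _ hle).trans h)
      _ = #(regularContaining d H) * (N / 2).descFactorial #H * d ^ 2 := by ring
      _ ≤ _ := Nat.mul_le_mul_right _ ih
      _ = _ := by ring

theorem two_mul_card_le_of_mem_regularContaining {V : Type*} [Fintype V] {d : ℕ}
    {H : Finset (Sym2 V)} {G : SimpleGraph V} (hG : G ∈ regularContaining d H) :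
    2 * #H ≤ Fintype.card V * d := by
  classical
  obtain ⟨h₁, h₂⟩ := mem_regularContaining.1 hG
  have h₃ : H ⊆ G.edgeFinset := by
    rw [← coe_subset, coe_edgeFinset]
    exact h₂
  have h₄ := G.sum_degrees_eq_twice_card_edges
  rw [sum_const_nat fun v _ => ?_, card_univ] at h₄
  · rw [h₄]
    exact Nat.mul_le_mul_left _ (card_le_card h₃)
  · rw [← h₁ v, Set.ncard_eq_toFinset_card']
    rfl

theorem regularContaining_anti {V : Type*} [Fintype V] (d : ℕ) {H H' : Finset (Sym2 V)}
    (h : H ⊆ H') : regularContaining d H' ⊆ regularContaining d H := by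
  intro G
  simp only [mem_regularContaining]
  exact fun hG => ⟨hG.1, (coe_subset.2 h).trans hG.2⟩

/-- In a random `d`-regular graph on `n` vertices, any `m` prescribed edges are all present with
probability at most `(C / n) ^ m`. -/
theorem exists_card_regularContaining_le (d : ℕ) (hd : 3 ≤ d) :
    ∃ C : ℝ, 1 ≤ C ∧ ∀ᶠ n : ℕ in Filter.atTop, ∀ H : Finset (Sym2 (Fin n)),
      (#(regularContaining d H) : ℝ) ≤
        #(regularContaining d (∅ : Finset (Sym2 (Fin n)))) * (C / n) ^ #H := by
  have he : 1 ≤ Real.exp 1 := Real.one_le_exp zero_le_one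
  have hd1 : (1 : ℝ) ≤ (d : ℝ) ^ 2 := one_le_pow₀ (by exact_mod_cast (by omega : 1 ≤ d))
  set C : ℝ := Real.exp 1 * (d : ℝ) ^ 2 with hC
  have hC1 : 1 ≤ C := one_le_mul_of_one_le_of_one_le he hd1
  set k := 1 + (d + 1) * d with hk
  have hpow : ∀ᶠ n : ℕ in Filter.atTop, (n : ℝ) ^ k ≤ 2 ^ n := by
    have := tendsto_pow_const_div_const_pow_of_one_lt k (one_lt_two (α := ℝ))
    filter_upwards [this.eventually (gt_mem_nhds one_pos)] with n hn
    rw [div_lt_one (by positivity)] at hn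
    exact hn.le
  refine ⟨2 * C, by linarith, ?_⟩
  filter_upwards [hpow, Filter.eventually_ge_atTop (2 * k)] with n hn hnk H
  have hn0 : (0 : ℝ) < n := by
    have : 0 < n := by omega
    exact_mod_cast this
  set R := #(regularContaining d (∅ : Finset (Sym2 (Fin n))))
  set M := (Fintype.card (Fin n) * d - 2 - 2 * ((d + 1) * d)) / 2 with hM
  rw [Fintype.card_fin] at hM
  have hnd : 3 * n ≤ n * d := by nlinarith
  have hnM : n ≤ M := by omega
  have hsmall : ∀ H : Finset (Sym2 (Fin n)), #H ≤ M →
      (#(regularContaining d H) : ℝ) ≤ R * (C / n) ^ #H := by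
    intro H hH
    have h₁ : (#(regularContaining d H) : ℝ) * M.descFactorial #H ≤ R * ((d : ℝ) ^ 2) ^ #H := by
      exact_mod_cast card_regularContaining_mul_descFactorial_le d H
    have h₂ := Nat.pow_le_exp_pow_mul_descFactorial hH
    have h₃ : (n : ℝ) ^ #H ≤ (M : ℝ) ^ #H := by gcongr
    rw [div_pow, mul_div_assoc', le_div_iff₀ (by positivity)]
    calc (#(regularContaining d H) : ℝ) * (n : ℝ) ^ #H
        ≤ #(regularContaining d H) * (Real.exp 1 ^ #H * M.descFactorial #H) := by
          gcongr
          exact h₃.trans h₂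
      _ = Real.exp 1 ^ #H * (#(regularContaining d H) * M.descFactorial #H) := by ring
      _ ≤ Real.exp 1 ^ #H * (R * ((d : ℝ) ^ 2) ^ #H) := by gcongr
      _ = R * C ^ #H := by rw [hC, mul_pow]; ring
  rcases le_or_gt #H M with hH | hH
  · refine (hsmall H hH).trans ?_
    gcongr
    linarith
  rcases (regularContaining d H).eq_empty_or_nonempty with h0 | ⟨G, hG⟩
  · rw [h0, card_empty, Nat.cast_zero]
    positivity
  have hle := two_mul_card_le_of_mem_regularContaining hG
  rw [Fintype.card_fin] at hle
  have hHk : #H ≤ M + k := by omega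
  obtain ⟨H', hH', hcard⟩ := exists_subset_card_eq hH.le
  calc (#(regularContaining d H) : ℝ) ≤ #(regularContaining d H') := by
        exact_mod_cast card_le_card (regularContaining_anti d hH')
    _ ≤ R * (C / n) ^ M := by simpa [hcard] using hsmall H' hcard.le
    _ ≤ R * (2 * C / n) ^ #H := by
        gcongr
        rw [div_pow, div_pow, div_le_div_iff₀ (by positivity) (by positivity)]
        calc C ^ M * (n : ℝ) ^ #H ≤ C ^ #H * (n : ℝ) ^ (M + k) := by
              gcongr
              exact_mod_cast (by omega : 1 ≤ n)
          _ = C ^ #H * (n : ℝ) ^ M * (n : ℝ) ^ k := by ring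
          _ ≤ C ^ #H * (n : ℝ) ^ M * 2 ^ #H := by
              gcongr
              exact hn.trans (pow_le_pow_right₀ one_le_two (by omega))
          _ = _ := by ring

theorem exists_isRegular_zmod {n d : ℕ} [NeZero n] (hn : 2 * d + 2 ≤ n) (hnd : Even (n * d)) :
    ∃ G : SimpleGraph (ZMod n), ∀ v, (G.neighborSet v).ncard = d := by
  obtain ⟨T, hT0, hTn, hTs, hTc⟩ : ∃ T : Finset ℕ, 0 ∉ T ∧ (∀ t ∈ T, t < n) ∧
      (∀ t ∈ T, n - t ∈ T) ∧ #T = d := by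
    rcases Nat.even_or_odd' d with ⟨k, rfl | rfl⟩
    · refine ⟨Icc 1 k ∪ Ico (n - k) n, ?_, ?_, ?_, ?_⟩
      · simp; omega
      · simp; omega
      · simp; omega
      · rw [card_union_of_disjoint]
        · simp; omega
        · rw [Finset.disjoint_left]; simp; omega
    · have h2 : Even n := by
        rcases Nat.even_mul.1 hnd with h | h
        · exact h
        · exact absurd h (by simp)
      obtain ⟨r, rfl⟩ := h2
      refine ⟨insert r (Icc 1 k ∪ Ico (r + r - k) (r + r)), ?_, ?_, ?_, ?_⟩
      · simp only [mem_insert, mem_union, mem_Icc, mem_Ico]; omega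
      · simp only [mem_insert, mem_union, mem_Icc, mem_Ico]; omega
      · simp only [mem_insert, mem_union, mem_Icc, mem_Ico]; omega
      · rw [card_insert_of_notMem, card_union_of_disjoint]
        · simp; omega
        · rw [Finset.disjoint_left]; simp; omega
        · simp; omega
  refine ⟨⟨fun u v => (u - v).val ∈ T, ?_, ?_⟩, ?_⟩
  · refine ⟨fun u v h => ?_⟩
    have h' := hTs _ h
    have h0 : u - v ≠ 0 := by
      intro h0
      rw [h0, ZMod.val_zero] at h
      exact hT0 h
    rwa [← neg_sub, ZMod.neg_val, if_neg h0]
  · refine ⟨fun u h => ?_⟩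
    rw [sub_self, ZMod.val_zero] at h
    exact hT0 h
  · intro u
    have : ({v | (u - v).val ∈ T} : Set (ZMod n)) = (fun t : ℕ => u - (t : ZMod n)) '' T := by
      ext v
      simp only [Set.mem_ofPred_eq, Set.mem_image, mem_coe]
      constructor
      · exact fun h => ⟨_, h, by simp⟩
      · rintro ⟨t, ht, rfl⟩
        rwa [sub_sub_cancel, ZMod.val_natCast_of_lt (hTn t ht)]
    refine (congrArg Set.ncard this).trans ?_
    rw [Set.InjOn.ncard_image, Set.ncard_coe_finset, hTc]
    intro a ha b hb h
    have h' := congrArg ZMod.val (sub_right_injective h)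
    rwa [ZMod.val_natCast_of_lt (hTn a ha), ZMod.val_natCast_of_lt (hTn b hb)] at h'

theorem regularContaining_empty_nonempty {n d : ℕ} (hn : 2 * d + 2 ≤ n) (hnd : Even (n * d)) :
    (regularContaining d (∅ : Finset (Sym2 (Fin n)))).Nonempty := by
  cases n with
  | zero => omega
  | succ n =>
    obtain ⟨G, hG⟩ := exists_isRegular_zmod hn hnd
    exact ⟨(G : SimpleGraph (Fin (n + 1))), mem_regularContaining.2 ⟨hG, by simp⟩⟩

end SimpleGraph

namespace Equiv.Perm

variable {X : Type*} [Fintype X] {τ : Perm X}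

theorem mem_of_sameCycle {H : Finset X} (hH : ∀ e ∈ H, τ e ∈ H) {e e' : X} (he : e ∈ H)
    (h : τ.SameCycle e e') : e' ∈ H := by
  obtain ⟨i, -, rfl⟩ := h.exists_pow_eq'
  clear h
  induction i with
  | zero => simpa
  | succ i ih => rw [pow_succ', mul_apply]; exact hH _ ih

theorem apply_eq_of_sameCycle {f : X → ℝ} (hf : ∀ e, f (τ e) = f e) {e e' : X}
    (h : τ.SameCycle e e') : f e' = f e := by
  obtain ⟨i, -, rfl⟩ := h.exists_pow_eq'
  clear h
  induction i with
  | zero => simp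
  | succ i ih => rw [pow_succ', mul_apply, hf, ih]

theorem prod_sameCycle_le_pow [DecidableRel τ.SameCycle] {f : X → ℝ} (hf : ∀ e, f (τ e) = f e)
    {e : X} (h0 : 0 ≤ f e) (h1 : f e ≤ 1) {T : Finset X} (hT : ∀ e' ∈ T, τ.SameCycle e e') :
    ∏ e' with τ.SameCycle e e', f e' ≤ f e ^ #T := by
  rw [prod_congr rfl fun e' he' => apply_eq_of_sameCycle hf (mem_filter.1 he').2, prod_const]
  refine pow_le_pow_of_le_one h0 h1 (card_le_card fun e' he' => ?_)
  simpa using hT e' he'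

theorem prod_sameCycle_le_self [DecidableRel τ.SameCycle] {f : X → ℝ} (hf : ∀ e, f (τ e) = f e)
    {e : X} (h0 : 0 ≤ f e) (h1 : f e ≤ 1) :
    ∏ e' with τ.SameCycle e e', f e' ≤ f e := by
  simpa using prod_sameCycle_le_pow hf h0 h1 (T := {e}) (by simp [SameCycle.refl])

variable [DecidableEq X]

/-- A weighted sum over `τ`-invariant subsets of `E`, bounded by choosing each orbit of `τ`
independently. -/
theorem sum_prod_invariant_le [DecidableRel τ.SameCycle] {f : X → ℝ} (hf : ∀ e, 0 ≤ f e)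
    {E : Finset X} {𝓗 : Finset (Finset X)}
    (hE : ∀ H ∈ 𝓗, H ⊆ E) (hτ : ∀ H ∈ 𝓗, ∀ e ∈ H, τ e ∈ H) :
    ∑ H ∈ 𝓗, ∏ e ∈ H, f e ≤ ∏ e ∈ E, (1 + ∏ e' with τ.SameCycle e e', f e') := by
  let rep : X → X := fun e => (Quotient.mk (SameCycle.setoid τ) e).out
  have hrep : ∀ e, τ.SameCycle (rep e) e := fun e =>
    Quotient.mk_out (s := SameCycle.setoid τ) e
  have hrep_eq : ∀ {e e'}, τ.SameCycle e e' → rep e = rep e' := fun h =>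
    congrArg Quotient.out (Quotient.sound h)
  have hmem : ∀ H ∈ 𝓗, ∀ e, e ∈ H ↔ rep e ∈ H.image rep := by
    intro H hH e
    refine ⟨mem_image_of_mem rep, fun h => ?_⟩
    obtain ⟨e', he', h⟩ := mem_image.1 h
    exact mem_of_sameCycle (hτ H hH) he' ((hrep e').symm.trans (h ▸ hrep e))
  have hprod : ∀ H ∈ 𝓗,
      ∏ e ∈ H, f e = ∏ c ∈ H.image rep, ∏ e' with τ.SameCycle c e', f e' := by
    intro H hH
    rw [← prod_fiberwise_of_maps_to (g := rep) (t := H.image rep)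
      fun e he => mem_image_of_mem rep he]
    refine prod_congr rfl fun c hc => ?_
    congr 1
    obtain ⟨e₀, he₀, rfl⟩ := mem_image.1 hc
    ext e
    simp only [mem_filter, mem_univ, true_and]
    constructor
    · rintro ⟨-, h⟩
      rw [← h]
      exact hrep e
    · intro h
      have h' := (hrep e₀).symm.trans h
      exact ⟨mem_of_sameCycle (hτ H hH) he₀ h', (hrep_eq h').symm⟩
  have hinj : Set.InjOn (fun H : Finset X => H.image rep) 𝓗 := by
    intro H hH H' hH' h
    ext e
    rw [hmem H hH, hmem H' hH']
    exact iff_of_eq (congrArg (rep e ∈ ·) h)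
  calc ∑ H ∈ 𝓗, ∏ e ∈ H, f e
      = ∑ T ∈ 𝓗.image fun H => H.image rep, ∏ c ∈ T, ∏ e' with τ.SameCycle c e', f e' := by
        rw [sum_image hinj]
        exact sum_congr rfl hprod
    _ ≤ ∑ T ∈ E.powerset, ∏ c ∈ T, ∏ e' with τ.SameCycle c e', f e' := by
        refine sum_le_sum_of_subset_of_nonneg ?_ fun T _ _ =>
          prod_nonneg fun c _ => prod_nonneg fun e _ => hf e
        intro T hT
        obtain ⟨H, hH, rfl⟩ := mem_image.1 hT
        rw [mem_powerset]
        intro c hc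
        obtain ⟨e, he, rfl⟩ := mem_image.1 hc
        exact hE H hH (mem_of_sameCycle (hτ H hH) he (hrep e).symm)
    _ = _ := (prod_one_add _).symm

theorem prod_sameCycle_le_pow_prime [DecidableRel τ.SameCycle] {f : X → ℝ}
    (hf : ∀ e, f (τ e) = f e) {e : X} (h0 : 0 ≤ f e) (h1 : f e ≤ 1) {p : ℕ} (hp : p.Prime)
    (hτ : τ ^ p = 1) (he : τ e ≠ e) :
    ∏ e' with τ.SameCycle e e', f e' ≤ f e ^ p := by
  have := Fact.mk hp
  have hper : Function.minimalPeriod τ e = p := by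
    refine Function.minimalPeriod_eq_prime ?_ he
    rw [Function.IsPeriodicPt, Function.IsFixedPt, iterate_eq_pow, hτ, one_apply]
  have hcard : #((range p).image fun i => (τ ^ i) e) = p := by
    rw [card_image_of_injOn, card_range]
    have := Function.iterate_injOn_Iio_minimalPeriod (f := τ) (x := e)
    rw [hper] at this
    simpa [iterate_eq_pow] using this
  have h := prod_sameCycle_le_pow hf h0 h1 (T := (range p).image fun i => (τ ^ i) e) ?_
  · rwa [hcard] at h
  · intro e' he'
    obtain ⟨i, -, rfl⟩ := mem_image.1 he'
    exact ⟨i, by simp⟩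

end Equiv.Perm

/-- The action of permutations on unordered pairs. -/
def Equiv.Perm.sym2Hom (V : Type*) : Equiv.Perm V →* Equiv.Perm (Sym2 V) where
  toFun σ :=
    { toFun := Sym2.map σ
      invFun := Sym2.map σ.symm
      left_inv := fun e => by simp [Sym2.map_map]
      right_inv := fun e => by simp [Sym2.map_map] }
  map_one' := by ext e : 1; simp
  map_mul' σ σ' := by ext e : 1; simp [Sym2.map_map]

namespace SimpleGraph

variable {V : Type*} [DecidableEq V]

/-- The weight `w * t ^ k` of a pair with `k` elements in `S`. -/
def pairWeight (S : Finset V) (w t : ℝ) (e : Sym2 V) : ℝ :=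
  w * t ^ #{v ∈ S | v ∈ e}

theorem pairWeight_of_mem_of_mem {S : Finset V} {u v : V} (hu : u ∈ S) (hv : v ∈ S) (huv : u ≠ v)
    (w t : ℝ) : pairWeight S w t s(u, v) = w * t ^ 2 := by
  have : ({x ∈ S | x ∈ s(u, v)} : Finset V) = {u, v} := by
    ext x
    simp only [mem_filter, Sym2.mem_iff, mem_insert, mem_singleton]
    exact ⟨fun h => h.2, by rintro (rfl | rfl) <;> simp [*]⟩
  rw [pairWeight, this, card_pair huv]

theorem pairWeight_of_mem_of_notMem {S : Finset V} {u v : V} (hu : u ∈ S) (hv : v ∉ S)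
    (w t : ℝ) : pairWeight S w t s(u, v) = w * t := by
  have : ({x ∈ S | x ∈ s(u, v)} : Finset V) = {u} := by
    ext x
    simp only [mem_filter, Sym2.mem_iff, mem_singleton]
    exact ⟨by rintro ⟨h, rfl | rfl⟩ <;> simp_all, by rintro rfl; simp [hu]⟩
  rw [pairWeight, this, card_singleton, pow_one]

variable [Fintype V]

theorem sum_card_filter_mem_edges {d : ℕ} {G : SimpleGraph V}
    (hG : ∀ v, (G.neighborSet v).ncard = d) {S : Finset V} {H : Finset (Sym2 V)}
    (hH : ∀ e, e ∈ H ↔ e ∈ G.edgeSet ∧ ∃ v ∈ S, v ∈ e) :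
    ∑ e ∈ H, #{v ∈ S | v ∈ e} = #S * d := by
  classical
  refine (sum_card_bipartiteAbove_eq_sum_card_bipartiteBelow (s := H) (t := S)
    (fun e v => v ∈ e)).trans (sum_const_nat fun v hv => ?_)
  have h : bipartiteBelow (fun e v => v ∈ e) H v = G.incidenceFinset v := by
    ext e
    rw [mem_bipartiteBelow, hH, mem_incidenceFinset]
    exact ⟨fun h => ⟨h.1.1, h.2⟩, fun h => ⟨⟨h.1, v, hv, h.2⟩, h.2⟩⟩
  rw [h, card_incidenceFinset_eq_degree, ← hG v, Set.ncard_eq_toFinset_card']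
  rfl

theorem pairWeight_sym2Hom (σ : Equiv.Perm V) (w t : ℝ) (e : Sym2 V) :
    pairWeight σ.support w t (Equiv.Perm.sym2Hom V σ e) = pairWeight σ.support w t e := by
  rw [pairWeight, pairWeight]
  congr 2
  symm
  refine card_bij (fun v _ => σ v) ?_ (fun _ _ _ _ h => σ.injective h) ?_
  · intro v hv
    rw [mem_filter] at hv ⊢
    exact ⟨Equiv.Perm.apply_mem_support.2 hv.1, Sym2.mem_map.2 ⟨v, hv.2, rfl⟩⟩
  · intro v hv
    rw [mem_filter] at hv
    obtain ⟨u, hu, rfl⟩ := Sym2.mem_map.1 hv.2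
    exact ⟨u, mem_filter.2 ⟨Equiv.Perm.apply_mem_support.1 hv.1, hu⟩, rfl⟩

theorem sum_orbit_weights_le {σ : Equiv.Perm V} {p : ℕ} (hp : p.Prime) (hσ : σ ^ p = 1)
    {τ : Equiv.Perm (Sym2 V)} (hτ : τ = Equiv.Perm.sym2Hom V σ) [DecidableRel τ.SameCycle]
    {w t B : ℝ} (hw : 0 ≤ w) (ht : 1 ≤ t) (hwt : w * t ^ 2 ≤ 1)
    (hs : #σ.support * (w * t ^ 2) ^ p ≤ 1) (hB : Fintype.card V * (w * t) ^ p ≤ B) :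
    ∑ e with ¬ e.IsDiag ∧ ∃ v ∈ σ.support, v ∈ e,
      ∏ e' with τ.SameCycle e e', pairWeight σ.support w t e' ≤
    (2 + B) * #σ.support := by
  set S := σ.support with hS
  set E : Finset (Sym2 V) := {e | ¬ e.IsDiag ∧ ∃ v ∈ S, v ∈ e} with hE
  set F : Sym2 V → ℝ := fun e => ∏ e' with τ.SameCycle e e', pairWeight S w t e' with hF
  have ht0 : 0 ≤ t := by linarith
  have hwt1 : w * t ≤ 1 := by
    refine le_trans ?_ hwt
    gcongr
    exact le_self_pow₀ ht two_ne_zero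
  have hτp : τ ^ p = 1 := by rw [hτ, ← map_pow, hσ, map_one]
  have hcases : ∀ e ∈ E, (∃ u ∈ S, ∃ v ∈ S, u ≠ v ∧ e = s(u, v)) ∨
      (∃ u ∈ S, ∃ v, v ∉ S ∧ e = s(u, v)) := by
    intro e he
    obtain ⟨h₁, u, hu, h₂⟩ := (mem_filter.1 he).2
    obtain ⟨v, rfl⟩ := h₂
    by_cases hv : v ∈ S
    · exact Or.inl ⟨u, hu, v, hv, by simpa using h₁, rfl⟩
    · exact Or.inr ⟨u, hu, v, hv, rfl⟩
  have hinv : ∀ e, pairWeight S w t (τ e) = pairWeight S w t e := hτ ▸ pairWeight_sym2Hom σ w t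
  have h0 : ∀ e, 0 ≤ pairWeight S w t e := fun e => by unfold pairWeight; positivity
  have h1 : ∀ e ∈ E, pairWeight S w t e ≤ 1 := by
    intro e he
    obtain ⟨u, hu, v, hv, huv, rfl⟩ | ⟨u, hu, v, hv, rfl⟩ := hcases e he
    · rwa [pairWeight_of_mem_of_mem hu hv huv]
    · rwa [pairWeight_of_mem_of_notMem hu hv]
  have hfix : ∑ e ∈ E with τ e = e, F e ≤ #S := by
    have hcard : #{e ∈ E | τ e = e} ≤ #S := by
      refine le_trans (card_le_card fun e he => ?_) (card_image_le (f := fun u => s(u, σ u)))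
      obtain ⟨he, hτe⟩ := mem_filter.1 he
      have key : ∀ u ∈ S, ∀ v, τ s(u, v) = s(u, v) → v = σ u := by
        intro u hu v h
        have h' : s(σ u, σ v) = s(u, v) := by rwa [hτ] at h
        rw [Sym2.eq_iff] at h'
        rcases h' with h' | h'
        · exact absurd h'.1 (Equiv.Perm.mem_support.1 hu)
        · exact h'.1.symm
      obtain ⟨u, hu, v, hv, huv, rfl⟩ | ⟨u, hu, v, hv, rfl⟩ := hcases e he <;>
      · rw [key u hu v hτe]
        exact mem_image_of_mem _ hu
    calc ∑ e ∈ E with τ e = e, F e ≤ #{e ∈ E | τ e = e} • (1 : ℝ) := by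
          refine sum_le_card_nsmul _ _ _ fun e he => ?_
          have he := (mem_filter.1 he).1
          exact (Equiv.Perm.prod_sameCycle_le_self hinv (h0 e) (h1 e he)).trans (h1 e he)
      _ ≤ #S := by rw [nsmul_one]; exact_mod_cast hcard
  have hin : ∑ e ∈ E.filter (fun e => ¬ τ e = e) with ∃ u ∈ S, ∃ v ∈ S, u ≠ v ∧ e = s(u, v), F e
      ≤ #S := by
    set A := {e ∈ E.filter (fun e => ¬ τ e = e) | ∃ u ∈ S, ∃ v ∈ S, u ≠ v ∧ e = s(u, v)} with hA
    have hcard : #A ≤ #S * #S := by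
      rw [← card_product]
      refine le_trans (card_le_card fun e he => ?_)
        (card_image_le (f := fun q : V × V => s(q.1, q.2)))
      obtain ⟨u, hu, v, hv, huv, rfl⟩ := (mem_filter.1 he).2
      exact mem_image.2 ⟨(u, v), mem_product.2 ⟨hu, hv⟩, rfl⟩
    calc ∑ e ∈ A, F e ≤ #A • (w * t ^ 2) ^ p := by
          refine sum_le_card_nsmul _ _ _ fun e he => ?_
          obtain ⟨he, u, hu, v, hv, huv, rfl⟩ := mem_filter.1 he
          obtain ⟨he, hne⟩ := mem_filter.1 he
          have := Equiv.Perm.prod_sameCycle_le_pow_prime hinv (h0 _) (h1 _ he) hp hτp hne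
          rwa [pairWeight_of_mem_of_mem hu hv huv] at this
      _ ≤ (#S * #S : ℕ) * (w * t ^ 2) ^ p := by
          rw [nsmul_eq_mul]
          gcongr
      _ = #S * (#S * (w * t ^ 2) ^ p) := by push_cast; ring
      _ ≤ #S * 1 := by gcongr
      _ = #S := mul_one _
  have hout : ∑ e ∈ E.filter (fun e => ¬ τ e = e) with ¬ ∃ u ∈ S, ∃ v ∈ S, u ≠ v ∧ e = s(u, v),
      F e ≤ B * #S := by
    set A := {e ∈ E.filter (fun e => ¬ τ e = e) | ¬ ∃ u ∈ S, ∃ v ∈ S, u ≠ v ∧ e = s(u, v)} with hA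
    have hA' : ∀ e ∈ A, ∃ u ∈ S, ∃ v, v ∉ S ∧ e = s(u, v) := by
      intro e he
      obtain ⟨he, hn⟩ := mem_filter.1 he
      exact (hcases e (mem_filter.1 he).1).resolve_left hn
    have hcard : #A ≤ #S * Fintype.card V := by
      rw [← card_univ, ← card_product]
      refine le_trans (card_le_card fun e he => ?_)
        (card_image_le (f := fun q : V × V => s(q.1, q.2)))
      obtain ⟨u, hu, v, hv, rfl⟩ := hA' e he
      exact mem_image.2 ⟨(u, v), mem_product.2 ⟨hu, mem_univ v⟩, rfl⟩
    calc ∑ e ∈ A, F e ≤ #A • (w * t) ^ p := by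
          refine sum_le_card_nsmul _ _ _ fun e he => ?_
          obtain ⟨u, hu, v, hv, rfl⟩ := hA' e he
          obtain ⟨he, hne⟩ := mem_filter.1 (mem_filter.1 he).1
          have := Equiv.Perm.prod_sameCycle_le_pow_prime hinv (h0 _) (h1 _ he) hp hτp hne
          rwa [pairWeight_of_mem_of_notMem hu hv] at this
      _ ≤ (#S * Fintype.card V : ℕ) * (w * t) ^ p := by
          rw [nsmul_eq_mul]
          gcongr
      _ = (Fintype.card V * (w * t) ^ p) * #S := by push_cast; ring
      _ ≤ B * #S := by gcongr
  change ∑ e ∈ E, F e ≤ _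
  rw [← sum_filter_add_sum_filter_not E (fun e => τ e = e),
    ← sum_filter_add_sum_filter_not (E.filter fun e => ¬ τ e = e)
      (fun e => ∃ u ∈ S, ∃ v ∈ S, u ≠ v ∧ e = s(u, v))]
  linarith

theorem card_regularFixed_le {d : ℕ} {σ : Equiv.Perm V} {p : ℕ} (hp : p.Prime) (hσ : σ ^ p = 1)
    {w t B : ℝ} (hw : 0 ≤ w) (ht : 1 ≤ t) (hwt : w * t ^ 2 ≤ 1)
    (hs : #σ.support * (w * t ^ 2) ^ p ≤ 1) (hB : Fintype.card V * (w * t) ^ p ≤ B)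
    (hR : ∀ H : Finset (Sym2 V), (#(regularContaining d H) : ℝ) ≤
      #(regularContaining d (∅ : Finset (Sym2 V))) * w ^ #H) :
    (#(regularFixed d σ) : ℝ) * t ^ (#σ.support * d) ≤
      #(regularContaining d (∅ : Finset (Sym2 V))) * Real.exp ((2 + B) * #σ.support) := by
  classical
  obtain ⟨τ, hτ⟩ : ∃ τ, τ = Equiv.Perm.sym2Hom V σ := ⟨_, rfl⟩
  let edges : SimpleGraph V → Finset (Sym2 V) := fun G =>
    {e | e ∈ G.edgeSet ∧ ∃ v ∈ σ.support, v ∈ e}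
  have hedges : ∀ G e, e ∈ edges G ↔ e ∈ G.edgeSet ∧ ∃ v ∈ σ.support, v ∈ e := by simp [edges]
  have hfixed : ∀ G ∈ regularFixed d σ, G ∈ regularContaining d (∅ : Finset (Sym2 V)) :=
    fun G hG => (mem_regularFixed.1 hG).1
  set 𝓗 := (regularFixed d σ).image edges with h𝓗
  set E : Finset (Sym2 V) := {e | ¬ e.IsDiag ∧ ∃ v ∈ σ.support, v ∈ e} with hE
  have hsum : ∑ H ∈ 𝓗, ∏ e ∈ H, pairWeight σ.support w t e ≤ Real.exp ((2 + B) * #σ.support) := by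
    refine (Equiv.Perm.sum_prod_invariant_le (τ := τ) (E := E)
      (fun e => by unfold pairWeight; positivity) ?_ ?_).trans ?_
    · intro H hH e he
      obtain ⟨G, -, rfl⟩ := mem_image.1 hH
      rw [hedges] at he
      exact mem_filter.2 ⟨mem_univ _, G.not_isDiag_of_mem_edgeSet he.1, he.2⟩
    · intro H hH e he
      obtain ⟨G, hG, rfl⟩ := mem_image.1 hH
      rw [hedges] at he ⊢
      rw [hτ]
      obtain ⟨h₁, v, hv, hve⟩ := he
      refine ⟨?_, σ v, Equiv.Perm.apply_mem_support.2 hv, Sym2.mem_map.2 ⟨v, hve, rfl⟩⟩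
      induction e with
      | _ a b => exact (mem_regularFixed.1 hG).2 a b h₁
    · have h := sum_orbit_weights_le hp hσ hτ hw ht hwt hs hB
      refine le_trans ?_ (Real.exp_le_exp.2 h)
      rw [Real.exp_sum]
      refine prod_le_prod (fun e _ => ?_) fun e _ => ?_
      · have : 0 ≤ ∏ e' with τ.SameCycle e e', pairWeight σ.support w t e' :=
          prod_nonneg fun e _ => by unfold pairWeight; positivity
        linarith
      · rw [add_comm]
        exact Real.add_one_le_exp _
  have hprod : ∀ H ∈ 𝓗, ∏ e ∈ H, pairWeight σ.support w t e = w ^ #H * t ^ (#σ.support * d) := by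
    intro H hH
    obtain ⟨G, hG, rfl⟩ := mem_image.1 hH
    have hreg := (mem_regularContaining.1 (hfixed G hG)).1
    simp only [pairWeight]
    rw [prod_mul_distrib, prod_const, prod_pow_eq_pow_sum,
      sum_card_filter_mem_edges hreg (hedges G)]
  have hcard : (#(regularFixed d σ) : ℝ) ≤
      ∑ H ∈ 𝓗, #(regularContaining d (∅ : Finset (Sym2 V))) * w ^ #H := by
    rw [card_eq_sum_card_image edges, Nat.cast_sum]
    refine sum_le_sum fun H _ => le_trans ?_ (hR H)
    rw [Nat.cast_le]
    refine card_le_card fun G hG => ?_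
    obtain ⟨hG, hGH⟩ := mem_filter.1 hG
    have hreg := (mem_regularContaining.1 (hfixed G hG)).1
    refine mem_regularContaining.2 ⟨hreg, fun e he => ?_⟩
    rw [← hGH] at he
    exact ((hedges G e).1 he).1
  calc (#(regularFixed d σ) : ℝ) * t ^ (#σ.support * d)
      ≤ (∑ H ∈ 𝓗, #(regularContaining d (∅ : Finset (Sym2 V))) * w ^ #H) *
          t ^ (#σ.support * d) := by
        gcongr
    _ = #(regularContaining d (∅ : Finset (Sym2 V))) *
          ∑ H ∈ 𝓗, ∏ e ∈ H, pairWeight σ.support w t e := by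
        rw [sum_congr rfl hprod, mul_sum, sum_mul]
        exact sum_congr rfl fun H _ => by ring
    _ ≤ _ := by gcongr

end SimpleGraph

theorem Equiv.Perm.card_cycleType_replicate_mul_le (V : Type*) [Fintype V] [DecidableEq V]
    (p c : ℕ) :
    #{σ : Equiv.Perm V | σ.cycleType = Multiset.replicate c p} * (p ^ c * c.factorial) ≤
      Fintype.card V ^ (p * c) := by
  have h := Equiv.Perm.card_of_cycleType_mul_eq V (Multiset.replicate c p)
  split_ifs at h with hs
  · rw [Multiset.sum_replicate, smul_eq_mul, mul_comm c p] at hs h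
    have hprod : ∏ k ∈ (Multiset.replicate c p).toFinset,
        ((Multiset.replicate c p).count k).factorial = c.factorial := by
      rcases eq_or_ne c 0 with rfl | hc
      · simp
      · rw [Multiset.toFinset_replicate, if_neg hc, prod_singleton, Multiset.count_replicate_self]
    rw [Multiset.prod_replicate, hprod, ← Nat.factorial_mul_descFactorial hs.1] at h
    refine le_trans (le_of_eq (Nat.eq_of_mul_eq_mul_left
      (Nat.factorial_pos (Fintype.card V - p * c)) ?_)) (Nat.descFactorial_le_pow _ (p * c))
    rw [← h]
    ring
  · rcases Nat.mul_eq_zero.1 h with h | h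
    · rw [h, zero_mul]
      exact Nat.zero_le _
    · have : p ^ c * c.factorial = 0 := by
        rw [Multiset.prod_replicate] at h
        have h₁ : ∏ k ∈ (Multiset.replicate c p).toFinset,
          ((Multiset.replicate c p).count k).factorial ≠ 0 :=
          prod_ne_zero_iff.2 fun k _ => Nat.factorial_ne_zero _
        have h₂ := Nat.factorial_ne_zero (Fintype.card V - (Multiset.replicate c p).sum)
        simp_all
      rw [this, mul_zero]
      exact Nat.zero_le _

theorem Equiv.Perm.card_cycleType_replicate_mul_pow_le (V : Type*) [Fintype V] [DecidableEq V]
    (p c : ℕ) :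
    (#{σ : Equiv.Perm V | σ.cycleType = Multiset.replicate c p} : ℝ) * ((p * c : ℕ) : ℝ) ^ c ≤
      (Fintype.card V : ℝ) ^ (p * c) * Real.exp 1 ^ c := by
  have h : ((#{σ : Equiv.Perm V | σ.cycleType = Multiset.replicate c p} *
      (p ^ c * c.factorial) : ℕ) : ℝ) ≤ ((Fintype.card V ^ (p * c) : ℕ) : ℝ) :=
    Nat.cast_le.2 (Equiv.Perm.card_cycleType_replicate_mul_le V p c)
  push_cast at h ⊢
  have hc := Real.pow_div_factorial_le_exp (x := c) (Nat.cast_nonneg c) c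
  rw [div_le_iff₀ (by positivity), ← Real.exp_one_pow c] at hc
  calc _ ≤ (#{σ : Equiv.Perm V | σ.cycleType = Multiset.replicate c p} : ℝ) *
        (p ^ c * (Real.exp 1 ^ c * c.factorial)) := by
        rw [mul_pow]
        gcongr
    _ = #{σ : Equiv.Perm V | σ.cycleType = Multiset.replicate c p} * (p ^ c * c.factorial) *
        Real.exp 1 ^ c := by ring
    _ ≤ _ := by gcongr

namespace SimpleGraph

theorem sum_card_regularFixed_le {n d p c : ℕ} (hd : 3 ≤ d) (hp : p.Prime) (hc : c ≠ 0)
    {C T : ℝ} (hC : 1 ≤ C) (hT : 1 ≤ T) (hTn : C * T ^ 2 = √n)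
    (hR : ∀ H : Finset (Sym2 (Fin n)), (#(regularContaining d H) : ℝ) ≤
      #(regularContaining d (∅ : Finset (Sym2 (Fin n)))) * (C / n) ^ #H) :
    (∑ σ : Equiv.Perm (Fin n) with σ.cycleType = Multiset.replicate c p,
      #(regularFixed d σ) : ℝ) ≤ #(regularContaining d (∅ : Finset (Sym2 (Fin n)))) *
        (Real.exp 1 * C * Real.exp (2 + C) / T) ^ (p * c) := by
  set N := #{σ : Equiv.Perm (Fin n) | σ.cycleType = Multiset.replicate c p} with hN
  set R := #(regularContaining d (∅ : Finset (Sym2 (Fin n)))) with hRdef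
  rcases eq_empty_or_nonempty
    ({σ | σ.cycleType = Multiset.replicate c p} : Finset (Equiv.Perm (Fin n))) with h | ⟨σ₀, hσ₀⟩
  · rw [h, sum_empty]
    positivity
  have hsupp : ∀ σ : Equiv.Perm (Fin n), σ.cycleType = Multiset.replicate c p →
      #σ.support = p * c := by
    intro σ hσ
    rw [← σ.sum_cycleType, hσ, Multiset.sum_replicate, smul_eq_mul, mul_comm]
  have hsn : p * c ≤ n := by
    rw [← hsupp σ₀ (mem_filter.1 hσ₀).2]
    simpa using card_le_univ σ₀.support
  have hs0 : 0 < p * c := Nat.mul_pos hp.pos (Nat.pos_of_ne_zero hc)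
  set s := p * c with hs
  have hs0' : (0 : ℝ) < s := by exact_mod_cast hs0
  have hn0 : (0 : ℝ) < n := by exact_mod_cast hs0.trans_le hsn
  obtain ⟨y, hy0, hyp⟩ : ∃ y : ℝ, 0 < y ∧ y ^ p = (s : ℝ)⁻¹ :=
    ⟨((s : ℝ)⁻¹) ^ ((p : ℝ)⁻¹), by positivity, Real.rpow_inv_natCast_pow (by positivity) hp.ne_zero⟩
  have hy1 : y ≤ 1 := by
    rw [← pow_le_one_iff_of_nonneg hy0.le hp.ne_zero, hyp]
    exact inv_le_one_of_one_le₀ (by exact_mod_cast hs0)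
  have hyn : √n ≤ y * n := by
    rw [Real.sqrt_le_left (by positivity)]
    have h₁ : (s : ℝ)⁻¹ ≤ y ^ 2 := hyp ▸ pow_le_pow_of_le_one hy0.le hy1 hp.two_le
    have h₂ : (n : ℝ)⁻¹ ≤ (s : ℝ)⁻¹ := inv_anti₀ hs0' (by exact_mod_cast hsn)
    calc (n : ℝ) = (n : ℝ)⁻¹ * n ^ 2 := by field_simp
      _ ≤ y ^ 2 * n ^ 2 := by gcongr; exact h₂.trans h₁
      _ = (y * n) ^ 2 := by ring
  obtain ⟨t, ht0, ht2⟩ : ∃ t : ℝ, 0 ≤ t ∧ C * t ^ 2 = y * n :=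
    ⟨√(y * n / C), Real.sqrt_nonneg _, by rw [Real.sq_sqrt (by positivity)]; field_simp⟩
  have hTt : T ≤ t := by
    refine le_of_sq_le_sq ?_ ht0
    refine le_of_mul_le_mul_left ?_ (zero_lt_one.trans_le hC)
    rw [hTn, ht2]
    exact hyn
  have ht1 : 1 ≤ t := hT.trans hTt
  have hwt2 : C / n * t ^ 2 = y := by
    rw [div_mul_eq_mul_div, ht2, mul_div_cancel_right₀ _ hn0.ne']
  have hwt : C / n * t ≤ 1 := by
    refine le_trans ?_ (hwt2.trans_le hy1)
    gcongr
    exact le_self_pow₀ ht1 two_ne_zero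
  have hB : (Fintype.card (Fin n) : ℝ) * (C / n * t) ^ p ≤ C := by
    rw [Fintype.card_fin]
    calc (n : ℝ) * (C / n * t) ^ p ≤ n * (C / n * t) ^ 2 := by
          gcongr n * ?_
          exact pow_le_pow_of_le_one (by positivity) hwt hp.two_le
      _ = C * (C / n * t ^ 2) := by field_simp
      _ ≤ C * 1 := by rw [hwt2]; gcongr
      _ = C := mul_one C
  have hfix : ∀ σ ∈ ({σ | σ.cycleType = Multiset.replicate c p} : Finset (Equiv.Perm (Fin n))),
      (#(regularFixed d σ) : ℝ) ≤ R * (Real.exp (2 + C) / t ^ 3) ^ s := by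
    intro σ hσ
    replace hσ := (mem_filter.1 hσ).2
    have hord : σ ^ p = 1 := by
      have := Fact.mk hp
      refine Equiv.Perm.pow_prime_eq_one_iff.2 fun k hk => ?_
      rw [hσ] at hk
      exact Multiset.eq_of_mem_replicate hk
    have h := card_regularFixed_le hp hord (by positivity) ht1 (hwt2.trans_le hy1)
      (by rw [hsupp σ hσ, hwt2, hyp, mul_inv_cancel₀ hs0'.ne']) hB hR
    rw [hsupp σ hσ, ← hRdef, mul_comm (2 + C), Real.exp_nat_mul] at h
    rw [div_pow, ← mul_div_assoc, le_div_iff₀ (by positivity), ← pow_mul]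
    refine le_trans ?_ h
    rw [mul_comm 3]
    gcongr
  have hcard : (N : ℝ) ≤ (Real.exp 1 * C * t ^ 2) ^ s := by
    have h := Equiv.Perm.card_cycleType_replicate_mul_pow_le (Fin n) p c
    rw [← hN, ← hs, Fintype.card_fin, ← le_div_iff₀ (by positivity)] at h
    have hys : ((s : ℝ) ^ c)⁻¹ = y ^ s := by rw [hs, pow_mul, hyp, inv_pow]
    rw [div_eq_mul_inv, hys] at h
    calc (N : ℝ) ≤ n ^ s * Real.exp 1 ^ c * y ^ s := h
      _ ≤ n ^ s * Real.exp 1 ^ s * y ^ s := by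
          gcongr
          · exact Real.one_le_exp zero_le_one
          · exact Nat.le_mul_of_pos_left c hp.pos
      _ = (Real.exp 1 * (y * n)) ^ s := by rw [mul_pow, mul_pow]; ring
      _ = _ := by rw [← ht2, mul_assoc]
  calc _ ≤ N • (R * (Real.exp (2 + C) / t ^ 3) ^ s) := sum_le_card_nsmul _ _ _ hfix
    _ ≤ (Real.exp 1 * C * t ^ 2) ^ s * (R * (Real.exp (2 + C) / t ^ 3) ^ s) := by
        rw [nsmul_eq_mul]
        gcongr
    _ = R * (Real.exp 1 * C * Real.exp (2 + C) / t) ^ s := by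
        rw [mul_left_comm, ← mul_pow]
        congr 2
        field_simp
    _ ≤ _ := by gcongr

theorem sum_sum_pow_mul_le {q : ℝ} (hq0 : 0 ≤ q) (hq : q ≤ 1 / 2) (n : ℕ) :
    ∑ i ∈ range n, ∑ j ∈ range n, q ^ ((i + 2) * (j + 1)) ≤ 4 * q ^ 2 := by
  have hgeom : ∑ i ∈ range n, q ^ i ≤ 2 := by
    have h := mul_neg_geom_sum q n
    have h₁ : 0 ≤ ∑ i ∈ range n, q ^ i := sum_nonneg fun i _ => by positivity
    have h₂ : 0 ≤ q ^ n := by positivity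
    nlinarith
  calc _ ≤ ∑ i ∈ range n, ∑ j ∈ range n, q ^ 2 * (q ^ i * q ^ j) := by
        refine sum_le_sum fun i _ => sum_le_sum fun j _ => ?_
        rw [← pow_add, ← pow_add]
        exact pow_le_pow_of_le_one hq0 (by linarith) (by nlinarith [Nat.zero_le (i * j)])
    _ = q ^ 2 * ((∑ i ∈ range n, q ^ i) * ∑ j ∈ range n, q ^ j) := by
        rw [sum_mul_sum, mul_sum]
        exact sum_congr rfl fun i _ => (mul_sum _ _ _).symm
    _ ≤ q ^ 2 * (2 * 2) := by
        gcongr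
    _ = 4 * q ^ 2 := by ring

theorem exists_prime_mem_regularFixed {n d : ℕ} {G : SimpleGraph (Fin n)}
    (hG : G ∈ regularContaining d (∅ : Finset (Sym2 (Fin n)))) (h : ¬ IsAsymmetric G) :
    ∃ i < n, ∃ j < n, (i + 2).Prime ∧ ∃ σ : Equiv.Perm (Fin n),
      σ.cycleType = Multiset.replicate (j + 1) (i + 2) ∧ G ∈ regularFixed d σ := by
  simp only [IsAsymmetric, not_forall] at h
  obtain ⟨e, v, hev⟩ := h
  have hne : orderOf (e.toEquiv : Equiv.Perm (Fin n)) ≠ 1 := by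
    rw [Ne, orderOf_eq_one_iff]
    intro h
    exact hev (DFunLike.congr_fun h v)
  obtain ⟨p, hp, hdvd⟩ := Nat.exists_prime_and_dvd hne
  set m := orderOf (e.toEquiv : Equiv.Perm (Fin n)) / p
  have hord : orderOf ((e.toEquiv : Equiv.Perm (Fin n)) ^ m) = p :=
    orderOf_pow_orderOf_div (orderOf_pos _).ne' hdvd
  obtain ⟨j, hj⟩ := Equiv.Perm.cycleType_prime_order (hord.symm ▸ hp)
  rw [hord] at hj
  have hle := Equiv.Perm.sum_cycleType_le ((e.toEquiv : Equiv.Perm (Fin n)) ^ m)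
  rw [hj, Multiset.sum_replicate, smul_eq_mul, Fintype.card_fin] at hle
  obtain ⟨i, rfl⟩ := Nat.exists_eq_add_of_le' hp.two_le
  refine ⟨i, by nlinarith, j, by nlinarith, hp, _, hj, mem_regularFixed.2 ⟨hG, ?_⟩⟩
  generalize m = k
  induction k with
  | zero => exact fun _ _ h => h
  | succ k ih =>
    intro u v huv
    rw [pow_succ', Equiv.Perm.mul_apply, Equiv.Perm.mul_apply]
    exact e.map_adj_iff.2 (ih u v huv)

open Classical in
theorem card_not_isAsymmetric_le {n d : ℕ} (hd : 3 ≤ d) {C T : ℝ} (hC : 1 ≤ C) (hT : 1 ≤ T)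
    (hTn : C * T ^ 2 = √n)
    (hR : ∀ H : Finset (Sym2 (Fin n)), (#(regularContaining d H) : ℝ) ≤
      #(regularContaining d (∅ : Finset (Sym2 (Fin n)))) * (C / n) ^ #H)
    (hq : Real.exp 1 * C * Real.exp (2 + C) / T ≤ 1 / 2) :
    (#{G ∈ regularContaining d (∅ : Finset (Sym2 (Fin n))) | ¬ IsAsymmetric G} : ℝ) ≤
      #(regularContaining d (∅ : Finset (Sym2 (Fin n)))) *
        (4 * (Real.exp 1 * C * Real.exp (2 + C) / T) ^ 2) := by
  set q := Real.exp 1 * C * Real.exp (2 + C) / T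
  set R := #(regularContaining d (∅ : Finset (Sym2 (Fin n))))
  have hq0 : 0 ≤ q := by positivity
  have hsub : {G ∈ regularContaining d (∅ : Finset (Sym2 (Fin n))) | ¬ IsAsymmetric G} ⊆
      {i ∈ range n | (i + 2).Prime}.biUnion fun i => (range n).biUnion fun j =>
        ({σ | σ.cycleType = Multiset.replicate (j + 1) (i + 2)} :
          Finset (Equiv.Perm (Fin n))).biUnion (regularFixed d) := by
    intro G hG
    obtain ⟨hG, h⟩ := mem_filter.1 hG
    obtain ⟨i, hi, j, hj, hp, σ, hσ, hGσ⟩ := exists_prime_mem_regularFixed hG h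
    simp only [mem_biUnion, mem_filter, mem_range, mem_univ, true_and]
    exact ⟨i, ⟨hi, hp⟩, j, hj, σ, hσ, hGσ⟩
  have hcard := (card_le_card hsub).trans <| card_biUnion_le.trans <| sum_le_sum fun i _ =>
    card_biUnion_le.trans <| sum_le_sum fun j _ => card_biUnion_le
  calc _ ≤ ((∑ i ∈ range n with (i + 2).Prime, ∑ j ∈ range n,
        ∑ σ : Equiv.Perm (Fin n) with σ.cycleType = Multiset.replicate (j + 1) (i + 2),
          #(regularFixed d σ) : ℕ) : ℝ) := Nat.cast_le.2 hcard
    _ ≤ ∑ i ∈ range n with (i + 2).Prime, ∑ j ∈ range n, R * q ^ ((i + 2) * (j + 1)) := by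
        push_cast
        refine sum_le_sum fun i hi => sum_le_sum fun j _ => ?_
        exact sum_card_regularFixed_le hd (mem_filter.1 hi).2 j.succ_ne_zero hC hT hTn hR
    _ ≤ ∑ i ∈ range n, ∑ j ∈ range n, R * q ^ ((i + 2) * (j + 1)) :=
        sum_le_sum_of_subset_of_nonneg (filter_subset _ _)
          fun i _ _ => sum_nonneg fun j _ => by positivity
    _ = R * ∑ i ∈ range n, ∑ j ∈ range n, q ^ ((i + 2) * (j + 1)) := by
        rw [mul_sum]
        exact sum_congr rfl fun i _ => (mul_sum _ _ _).symm
    _ ≤ R * (4 * q ^ 2) := by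
        gcongr
        exact sum_sum_pow_mul_le hq0 hq n

end SimpleGraph

end RandomRegularGraphs

theorem random_regular_asymmetric (d : ℕ) (hd : 3 ≤ d) :
    Filter.Tendsto
      (fun n : ℕ =>
        (({G : SimpleGraph (Fin n) |
            (∀ v, (G.neighborSet v).ncard = d) ∧ IsAsymmetric G}.ncard : ℝ) /
         ({G : SimpleGraph (Fin n) | ∀ v, (G.neighborSet v).ncard = d}.ncard : ℝ)))
      (Filter.atTop ⊓ Filter.principal {n : ℕ | Even (n * d)})
      (nhds 1) := by
  classical
  obtain ⟨C, hC, hR⟩ := SimpleGraph.exists_card_regularContaining_le d hd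
  have hC0 : 0 < C := zero_lt_one.trans_le hC
  set K := Real.exp 1 * C * Real.exp (2 + C)
  have hTlim : Filter.Tendsto (fun n : ℕ => √(√n / C)) Filter.atTop Filter.atTop :=
    Real.tendsto_sqrt_atTop.comp <| (Real.tendsto_sqrt_atTop.comp
      tendsto_natCast_atTop_atTop).atTop_div_const hC0
  have hqlim : Filter.Tendsto (fun n : ℕ => K / √(√n / C)) Filter.atTop (nhds 0) :=
    hTlim.const_div_atTop K
  have hlow : Filter.Tendsto (fun n : ℕ => 1 - 4 * (K / √(√n / C)) ^ 2) Filter.atTop (nhds 1) := by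
    simpa using ((hqlim.pow 2).const_mul 4).const_sub 1
  have hbound : ∀ᶠ n : ℕ in Filter.atTop ⊓ Filter.principal {n : ℕ | Even (n * d)},
      1 - 4 * (K / √(√n / C)) ^ 2 ≤
        (({G : SimpleGraph (Fin n) |
            (∀ v, (G.neighborSet v).ncard = d) ∧ IsAsymmetric G}.ncard : ℝ) /
         ({G : SimpleGraph (Fin n) | ∀ v, (G.neighborSet v).ncard = d}.ncard : ℝ)) := by
    rw [Filter.eventually_inf_principal]
    filter_upwards [hR, hTlim.eventually_ge_atTop 1, hqlim.eventually_le_const one_half_pos,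
      Filter.eventually_ge_atTop (2 * d + 2)] with n hR hT hq hn heven
    have hTn : C * √(√n / C) ^ 2 = √n := by
      rw [Real.sq_sqrt (by positivity), mul_div_cancel₀ _ hC0.ne']
    have hbad := SimpleGraph.card_not_isAsymmetric_le hd hC hT hTn hR hq
    have hpos : (0 : ℝ) < (SimpleGraph.regularContaining d (∅ : Finset (Sym2 (Fin n)))).card :=
      Nat.cast_pos.2 (SimpleGraph.regularContaining_empty_nonempty hn heven).card_pos
    have hden : {G : SimpleGraph (Fin n) | ∀ v, (G.neighborSet v).ncard = d} =
        (SimpleGraph.regularContaining d (∅ : Finset (Sym2 (Fin n))) :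
          Set (SimpleGraph (Fin n))) := by
      ext G
      simp [SimpleGraph.mem_regularContaining]
    have hnum : {G : SimpleGraph (Fin n) |
        (∀ v, (G.neighborSet v).ncard = d) ∧ IsAsymmetric G} =
        ({G ∈ SimpleGraph.regularContaining d (∅ : Finset (Sym2 (Fin n))) | IsAsymmetric G} :
          Finset (SimpleGraph (Fin n))) := by
      ext G
      simp [SimpleGraph.mem_regularContaining]
    have hadd := Finset.card_filter_add_card_filter_not
      (s := SimpleGraph.regularContaining d (∅ : Finset (Sym2 (Fin n)))) IsAsymmetric
    rw [hden, hnum, Set.ncard_coe_finset, Set.ncard_coe_finset, le_div_iff₀ hpos]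
    rw [← @Nat.cast_inj ℝ] at hadd
    push_cast at hadd
    linarith
  refine tendsto_of_tendsto_of_tendsto_of_le_of_le' (hlow.mono_left inf_le_left)
    tendsto_const_nhds hbound (Filter.Eventually.of_forall fun n => ?_)
  refine div_le_one_of_le₀ ?_ (Nat.cast_nonneg _)
  exact_mod_cast Set.ncard_le_ncard (fun G (hG : _ ∧ _) => hG.1) (Set.toFinite _)
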